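/- Let S₁, S₂, … be i.i.d. random variables with the exponential distribution of mean 1 and let x = (x₁, x₂, …) ∈ [0,∞)^ℕ satisfy 0 < Σ_i x_i < ∞. Define the normalized random variable L(x) = ( Σ_{i=1}^{∞} x_i·S_i − Σ_{i=1}^{∞} x_i ) / ( Σ_{i=1}^{∞} x_i² )^{1/2}. Then for every t ∈ (−∞, 0]: P[ L(x) ≤ t ] ≥ max{ 0, 1/2 + t }. -/

import Mathlib

open MeasureTheory ProbabilityTheory

/-- `μ` is the countable product of the probability measures `ν i`: it is a probability
measure giving every finite-dimensional cylinder set the product of the coordinate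
probabilities. -/
def IsPiNat {Y : Type*} [MeasurableSpace Y] (ν : ℕ → Measure Y) (μ : Measure (ℕ → Y)) : Prop :=
  IsProbabilityMeasure μ ∧
    ∀ (s : Finset ℕ) (A : ℕ → Set Y), (∀ i, MeasurableSet (A i)) →
      μ {y | ∀ i ∈ s, y i ∈ A i} = ∏ i ∈ s, ν i (A i)


open scoped ENNReal Topology

/-- multiplicative form of log-concavity -/
def LC (K : ℝ → ℝ≥0∞) : Prop :=
  ∀ z w a : ℝ, z ≤ w → 0 ≤ a → K (z - a) * K w ≤ K (w - a) * K z

lemma lintegral_expMeasure (g : ℝ → ℝ≥0∞) :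
    ∫⁻ s, g s ∂expMeasure 1 = ∫⁻ s in Set.Ici 0, ENNReal.ofReal (Real.exp (-s)) * g s := by
  have h1 : expMeasure 1 = volume.withDensity (exponentialPDF 1) := rfl
  have hm : Measurable (exponentialPDF 1) := by
    unfold exponentialPDF; fun_prop
  rw [h1, lintegral_withDensity_eq_lintegral_mul_non_measurable _ hm
    (ae_of_all _ (fun s => by simp [exponentialPDF])), ← lintegral_indicator measurableSet_Ici]
  congr 1
  ext s
  by_cases hs : 0 ≤ s
  · simp [hs, exponentialPDF_of_nonneg hs]
  · simp [hs, exponentialPDF_of_neg (not_le.1 hs)]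

lemma LC_integral (k : ℝ → ℝ≥0∞) (hk : LC k) (hm : Measurable k) :
    LC (fun z => ∫⁻ u in Set.Iic z, k u) := by
  intro z w a hzw ha
  have hsplit : ∀ g : ℝ → ℝ≥0∞, ∫⁻ u in Set.Iic w, g u
      = (∫⁻ u in Set.Iic z, g u) + ∫⁻ u in Set.Ioc z w, g u := by
    intro g
    rw [← Set.Iic_union_Ioc_eq_Iic hzw, lintegral_union measurableSet_Ioc]
    exact Set.disjoint_left.2 fun u hu hu' => not_lt.2 hu hu'.1
  have hshift : ∀ y : ℝ, ∫⁻ u in Set.Iic (y - a), k u = ∫⁻ u in Set.Iic y, k (u - a) := by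
    intro y
    rw [← lintegral_indicator measurableSet_Iic, ← lintegral_indicator measurableSet_Iic,
      ← lintegral_sub_right_eq_self _ a]
    congr 1
    ext u
    simp [Set.indicator]
  simp only [hshift]
  rw [hsplit k, hsplit (fun u => k (u - a)), mul_add, add_mul]
  refine add_le_add le_rfl ?_
  rw [← lintegral_const_mul _ hm, ← lintegral_mul_const _ (by fun_prop)]
  refine setLIntegral_mono' measurableSet_Ioc fun u hu => ?_
  rw [← lintegral_mul_const _ (by fun_prop), ← lintegral_const_mul _ hm]
  refine setLIntegral_mono' measurableSet_Iic fun v hv => ?_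
  exact hk v u a (le_trans hv hu.1.le) ha

lemma LC_mul_exp (K : ℝ → ℝ≥0∞) (hK : LC K) (c : ℝ) :
    LC (fun u => ENNReal.ofReal (Real.exp (c * u)) * K u) := by
  intro z w a h1 h2
  have h := hK z w a h1 h2
  have e : ENNReal.ofReal (Real.exp (c * (z - a))) * ENNReal.ofReal (Real.exp (c * w)) =
     ENNReal.ofReal (Real.exp (c * (w - a))) * ENNReal.ofReal (Real.exp (c * z)) := by
    rw [← ENNReal.ofReal_mul (Real.exp_nonneg _), ← ENNReal.ofReal_mul (Real.exp_nonneg _),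
      ← Real.exp_add, ← Real.exp_add]
    congr 2; ring
  simp only
  rw [mul_mul_mul_comm _ (K (z - a)), mul_mul_mul_comm _ (K (w - a)), e]
  exact mul_le_mul_right h _

lemma LC_conv (K : ℝ → ℝ≥0∞) (hK : LC K) (hm : Measurable K) (x : ℝ) (hx : 0 ≤ x) :
    LC (fun z => ∫⁻ s, K (z - x * s) ∂expMeasure 1) := by
  have := isProbabilityMeasure_expMeasure (r := 1) one_pos
  rcases hx.eq_or_lt with rfl | hx
  · simpa using hK
  have hK1 : LC (fun v => K (x * v)) := by
    intro z w a h1 h2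
    have := hK (x * z) (x * w) (x * a) (by gcongr) (by positivity)
    simpa [mul_sub] using this
  have key : ∀ v : ℝ, ∫⁻ s, K (x * v - x * s) ∂expMeasure 1 =
      ENNReal.ofReal (Real.exp ((-1) * v)) *
        ∫⁻ u in Set.Iic v, ENNReal.ofReal (Real.exp (1 * u)) * K (x * u) := by
    intro v
    rw [lintegral_expMeasure, ← lintegral_const_mul _ (by fun_prop),
      ← lintegral_indicator measurableSet_Iic, ← lintegral_indicator measurableSet_Ici,
      ← lintegral_sub_left_eq_self _ v]
    congr 1
    ext u
    by_cases hu : u ≤ v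
    · simp only [Set.indicator, Set.mem_Ici, sub_nonneg, hu, if_true, Set.mem_Iic]
      rw [← mul_assoc, ← ENNReal.ofReal_mul (Real.exp_nonneg _), ← Real.exp_add]
      congr 2
      · congr 1; ring
      · ring
    · simp [Set.indicator, hu]
  have h2 := LC_mul_exp _ (LC_integral _ (LC_mul_exp _ hK1 1) (by fun_prop)) (-1)
  intro z w a hzw ha
  have := h2 (z / x) (w / x) (a / x) (by gcongr) (by positivity)
  simp only [← key] at this
  have e1 : x * (z / x) = z := by field_simp
  have e2 : x * (w / x) = w := by field_simp
  have e3 : x * (z / x - a / x) = z - a := by field_simp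
  have e4 : x * (w / x - a / x) = w - a := by field_simp
  rw [e1, e2, e3, e4] at this
  exact this

lemma tail_aux {Ω : Type*} [MeasurableSpace Ω] (μ : Measure Ω) [IsProbabilityMeasure μ]
    (V : Ω → ℝ) (hV : Measurable V) (hV0 : ∀ ω, 0 ≤ V ω) (a : ℝ) (c d : ℝ≥0∞)
    (hc : c ≠ ∞) (hd : d ≠ ∞)
    (h : (∀ s > 0, c * μ {ω | s + a < V ω} ≤ d * μ {ω | s < V ω}) ∨
      (∀ s > 0, c * μ {ω | s + a ≤ V ω} ≤ d * μ {ω | s ≤ V ω})) (p : ℝ) (hp : 0 < p) :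
    c * ∫⁻ ω, ENNReal.ofReal ((max (V ω - a) 0) ^ p) ∂μ ≤ d * ∫⁻ ω, ENNReal.ofReal (V ω ^ p) ∂μ := by
  rcases h with h | h
  · rw [lintegral_rpow_eq_lintegral_meas_lt_mul μ (f := fun ω => max (V ω - a) 0)
      (ae_of_all _ (fun ω => le_max_right _ _)) (by fun_prop) hp, lintegral_rpow_eq_lintegral_meas_lt_mul μ (ae_of_all _ hV0)
      (by fun_prop) hp, mul_left_comm, mul_left_comm d, ← lintegral_const_mul' _ _ hc,
      ← lintegral_const_mul' _ _ hd]
    refine mul_le_mul_right (setLIntegral_mono' measurableSet_Ioi fun s hs => ?_) _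
    rw [← mul_assoc, ← mul_assoc]
    refine mul_le_mul_left ?_ _
    convert h s hs using 5
    have : 0 < s := hs
    rw [lt_max_iff]
    constructor
    · rintro (h | h) <;> linarith
    · intro h; left; linarith
  · rw [lintegral_rpow_eq_lintegral_meas_le_mul μ (f := fun ω => max (V ω - a) 0)
      (ae_of_all _ (fun ω => le_max_right _ _)) (by fun_prop) hp, lintegral_rpow_eq_lintegral_meas_le_mul μ (ae_of_all _ hV0)
      (by fun_prop) hp, mul_left_comm, mul_left_comm d, ← lintegral_const_mul' _ _ hc,
      ← lintegral_const_mul' _ _ hd]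
    refine mul_le_mul_right (setLIntegral_mono' measurableSet_Ioi fun s hs => ?_) _
    rw [← mul_assoc, ← mul_assoc]
    refine mul_le_mul_left ?_ _
    convert h s hs using 5
    have : 0 < s := hs
    rw [le_max_iff]
    constructor
    · rintro (h | h) <;> linarith
    · intro h; left; linarith

lemma tail_real {Ω : Type*} [MeasurableSpace Ω] (μ : Measure Ω) [IsProbabilityMeasure μ]
    (V : Ω → ℝ) (hV : Measurable V) (hV0 : ∀ ω, 0 ≤ V ω) (hi : Integrable V μ)
    (hi2 : Integrable (fun ω => V ω ^ 2) μ) (a : ℝ) (ha : 0 ≤ a) (c d : ℝ≥0∞)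
    (hc : c ≠ ∞) (hd : d ≠ ∞)
    (h : (∀ s > 0, c * μ {ω | s + a < V ω} ≤ d * μ {ω | s < V ω}) ∨
      (∀ s > 0, c * μ {ω | s + a ≤ V ω} ≤ d * μ {ω | s ≤ V ω})) :
    (c.toReal - d.toReal) * ∫ ω, V ω ∂μ ≤ c.toReal * (a * μ.real {ω | 0 < V ω}) ∧
    (c.toReal - d.toReal) * ∫ ω, V ω ^ 2 ∂μ ≤ c.toReal * (2 * a * ∫ ω, V ω ∂μ) := by
  have hle : ∀ ω, max (V ω - a) 0 ≤ V ω := fun ω => max_le (by linarith) (hV0 ω)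
  have hj : Integrable (fun ω => max (V ω - a) 0) μ := by
    refine hi.mono' (by fun_prop) (ae_of_all _ fun ω => ?_)
    rw [Real.norm_of_nonneg (le_max_right _ _)]; exact hle ω
  have hj2 : Integrable (fun ω => (max (V ω - a) 0) ^ 2) μ := by
    refine hi2.mono' (by fun_prop) (ae_of_all _ fun ω => ?_)
    rw [Real.norm_of_nonneg (by positivity)]
    have := hle ω
    gcongr
  have h1 := tail_aux μ V hV hV0 a c d hc hd h 1 one_pos
  have h2 := tail_aux μ V hV hV0 a c d hc hd h 2 two_pos
  simp only [Real.rpow_one, Real.rpow_two] at h1 h2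
  rw [← ofReal_integral_eq_lintegral_ofReal hj (ae_of_all _ fun ω => le_max_right _ _),
    ← ofReal_integral_eq_lintegral_ofReal hi (ae_of_all _ hV0)] at h1
  rw [← ofReal_integral_eq_lintegral_ofReal hj2 (ae_of_all _ fun ω => by positivity),
    ← ofReal_integral_eq_lintegral_ofReal hi2 (ae_of_all _ fun ω => by positivity)] at h2
  have h1' := ENNReal.toReal_mono (by finiteness) h1
  have h2' := ENNReal.toReal_mono (by finiteness) h2
  rw [ENNReal.toReal_mul, ENNReal.toReal_mul, ENNReal.toReal_ofReal
    (integral_nonneg (f := fun ω => max (V ω - a) 0) fun ω => le_max_right _ _), ENNReal.toReal_ofReal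
    (integral_nonneg hV0)] at h1'
  rw [ENNReal.toReal_mul, ENNReal.toReal_mul, ENNReal.toReal_ofReal
    (integral_nonneg fun ω => by positivity), ENNReal.toReal_ofReal
    (integral_nonneg fun ω => by positivity)] at h2'
  have hms : MeasurableSet {ω | 0 < V ω} := measurableSet_lt measurable_const hV
  have e1 : ∫ ω, V ω ∂μ - ∫ ω, max (V ω - a) 0 ∂μ ≤ a * μ.real {ω | 0 < V ω} := by
    rw [← integral_sub hi hj]
    have : a * μ.real {ω | 0 < V ω} = ∫ ω, {ω | 0 < V ω}.indicator (fun _ => a) ω ∂μ := by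
      rw [integral_indicator_const _ hms, smul_eq_mul, mul_comm]
    rw [this]
    refine integral_mono (hi.sub hj) ((integrable_const a).indicator hms) fun ω => ?_
    by_cases hω : 0 < V ω
    · simp only [Set.indicator, Set.mem_ofPred_eq, hω, if_true]
      linarith [le_max_left (V ω - a) 0]
    · simp only [Set.indicator, Set.mem_ofPred_eq, hω, if_false]
      linarith [le_max_right (V ω - a) 0]
  have e2 : ∫ ω, V ω ^ 2 ∂μ - ∫ ω, (max (V ω - a) 0) ^ 2 ∂μ ≤ 2 * a * ∫ ω, V ω ∂μ := by
    rw [← integral_sub hi2 hj2, ← integral_const_mul]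
    refine integral_mono (hi2.sub hj2) (hi.const_mul _) fun ω => ?_
    have := hV0 ω
    simp only
    rcases le_total (V ω) a with h | h
    · rw [max_eq_right (by linarith)]; nlinarith
    · rw [max_eq_left (by linarith)]; nlinarith
  have hc0 : 0 ≤ c.toReal := ENNReal.toReal_nonneg
  constructor
  · nlinarith [mul_le_mul_of_nonneg_left e1 hc0]
  · nlinarith [mul_le_mul_of_nonneg_left e2 hc0]

lemma step_ineq {Ω : Type*} [MeasurableSpace Ω] (μ : Measure Ω) [IsProbabilityMeasure μ]
    (W : Ω → ℝ) (hW : Measurable W) (hi : Integrable W μ)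
    (hi2 : Integrable (fun ω => W ω ^ 2) μ) (h0 : ∫ ω, W ω ∂μ = 0) (h1 : ∫ ω, W ω ^ 2 ∂μ = 1)
    (hF : LC (fun z => μ {ω | W ω ≤ z})) (hS : LC (fun z => μ {ω | z < W ω}))
    (z a : ℝ) (ha : 0 ≤ a) :
    ∃ A B : ℝ, 0 ≤ A ∧ 0 ≤ B ∧ A - B = - z ∧ A + B ≤ 1 + z ^ 2 ∧
      (μ.real {ω | W ω ≤ z} - μ.real {ω | W ω ≤ z - a}) * (1 + z ^ 2) ≤
        2 * a * ((1 - μ.real {ω | W ω ≤ z - a}) * A + μ.real {ω | W ω ≤ z} * B) ∧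
      (μ.real {ω | W ω ≤ z} - μ.real {ω | W ω ≤ z - a}) * B ≤ a * μ.real {ω | W ω ≤ z} ^ 2 := by
  have hcompl : ∀ y, μ.real {ω | y < W ω} = 1 - μ.real {ω | W ω ≤ y} := by
    intro y
    rw [← probReal_compl_eq_one_sub (measurableSet_le hW measurable_const)]
    congr 1; ext ω; simp
  have hiz : Integrable (fun ω => W ω - z) μ := hi.sub (integrable_const z)
  have hiz2 : Integrable (fun ω => (W ω - z) ^ 2) μ := by
    have : (fun ω => (W ω - z) ^ 2) = fun ω => W ω ^ 2 - 2 * z * W ω + z ^ 2 := by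
      ext ω; ring
    rw [this]
    exact (hi2.sub (hi.const_mul _)).add (integrable_const _)
  have hm2 : ∫ ω, (W ω - z) ^ 2 ∂μ = 1 + z ^ 2 := by
    have : (fun ω => (W ω - z) ^ 2) = fun ω => W ω ^ 2 - 2 * z * W ω + z ^ 2 := by
      ext ω; ring
    rw [this, integral_add (f := fun ω => W ω ^ 2 - 2 * z * W ω) (hi2.sub (hi.const_mul _))
      (integrable_const _), integral_sub hi2 (hi.const_mul _), integral_const_mul, h0, h1]
    simp
  have hA : Integrable (fun ω => max (W ω - z) 0) μ := hiz.pos_part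
  have hB : Integrable (fun ω => max (z - W ω) 0) μ := by
    have := hiz.neg.pos_part
    simpa using this
  have hA2 : Integrable (fun ω => max (W ω - z) 0 ^ 2) μ := by
    refine hiz2.mono' (by fun_prop) (ae_of_all _ fun ω => ?_)
    rw [Real.norm_of_nonneg (by positivity)]
    rcases le_total (W ω - z) 0 with h | h
    · rw [max_eq_right h]; nlinarith [sq_nonneg (W ω - z)]
    · rw [max_eq_left h]
  have hB2 : Integrable (fun ω => max (z - W ω) 0 ^ 2) μ := by
    refine hiz2.mono' (by fun_prop) (ae_of_all _ fun ω => ?_)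
    rw [Real.norm_of_nonneg (by positivity)]
    rcases le_total (z - W ω) 0 with h | h
    · rw [max_eq_right h]; nlinarith [sq_nonneg (W ω - z)]
    · rw [max_eq_left h]; apply le_of_eq; ring
  have hsum2 : ∫ ω, max (W ω - z) 0 ^ 2 ∂μ + ∫ ω, max (z - W ω) 0 ^ 2 ∂μ = 1 + z ^ 2 := by
    rw [← integral_add hA2 hB2, ← hm2]
    congr 1; ext ω
    rcases le_total (W ω) z with h | h
    · rw [max_eq_right (by linarith), max_eq_left (by linarith)]; ring
    · rw [max_eq_left (by linarith), max_eq_right (by linarith)]; ring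
  have hdiff : ∫ ω, max (W ω - z) 0 ∂μ - ∫ ω, max (z - W ω) 0 ∂μ = - z := by
    rw [← integral_sub hA hB]
    have : ∫ ω, (W ω - z) ∂μ = - z := by
      rw [integral_sub hi (integrable_const z), h0]; simp
    rw [← this]
    congr 1; ext ω
    rcases le_total (W ω) z with h | h
    · rw [max_eq_right (by linarith), max_eq_left (by linarith)]; ring
    · rw [max_eq_left (by linarith), max_eq_right (by linarith)]; ring
  have hsum : ∫ ω, max (W ω - z) 0 ∂μ + ∫ ω, max (z - W ω) 0 ∂μ ≤ 1 + z ^ 2 := by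
    have : ∫ ω, (1 + (W ω - z) ^ 2) / 2 ∂μ = (2 + z ^ 2) / 2 := by
      rw [integral_div, integral_add (integrable_const _) hiz2, hm2]
      simp; ring
    rw [← integral_add hA hB]
    calc _ ≤ ∫ ω, (1 + (W ω - z) ^ 2) / 2 ∂μ := by
          refine integral_mono (hA.add hB) (((integrable_const _).add hiz2).div_const _) fun ω => ?_
          simp only
          rcases le_total (W ω) z with h | h
          · rw [max_eq_right (by linarith), max_eq_left (by linarith)]
            nlinarith [sq_nonneg (W ω - z + 1)]
          · rw [max_eq_left (by linarith), max_eq_right (by linarith)]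
            nlinarith [sq_nonneg (W ω - z - 1)]
      _ ≤ _ := by rw [this]; nlinarith [sq_nonneg z]
  obtain ⟨-, tA⟩ := tail_real μ (fun ω => max (W ω - z) 0) (by fun_prop)
    (fun ω => le_max_right _ _) hA hA2 a ha (μ {ω | z - a < W ω}) (μ {ω | z < W ω})
    (by finiteness) (by finiteness) (Or.inl fun s hs => by
      have := hS z (z + s + a) a (by linarith) ha
      simp only at this
      have e1 : {ω | s + a < max (W ω - z) 0} = {ω | z + s + a < W ω} := by
        ext ω; simp only [Set.mem_ofPred_eq, lt_max_iff]
        constructor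
        · rintro (h | h) <;> linarith
        · intro h; left; linarith
      have e2 : {ω | s < max (W ω - z) 0} = {ω | z + s + a - a < W ω} := by
        ext ω; simp only [Set.mem_ofPred_eq, lt_max_iff]
        constructor
        · rintro (h | h) <;> linarith
        · intro h; left; linarith
      rw [e1, e2, mul_comm (μ {ω | z < W ω})]
      exact this)
  obtain ⟨tB1, tB⟩ := tail_real μ (fun ω => max (z - W ω) 0) (by fun_prop)
    (fun ω => le_max_right _ _) hB hB2 a ha (μ {ω | W ω ≤ z}) (μ {ω | W ω ≤ z - a})
    (by finiteness) (by finiteness) (Or.inr fun s hs => by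
      have := hF (z - s) z a (by linarith) ha
      simp only at this
      have e1 : {ω | s + a ≤ max (z - W ω) 0} = {ω | W ω ≤ z - s - a} := by
        ext ω; simp only [Set.mem_ofPred_eq, le_max_iff]
        constructor
        · rintro (h | h) <;> linarith
        · intro h; left; linarith
      have e2 : {ω | s ≤ max (z - W ω) 0} = {ω | W ω ≤ z - s} := by
        ext ω; simp only [Set.mem_ofPred_eq, le_max_iff]
        constructor
        · rintro (h | h) <;> linarith
        · intro h; left; linarith
      rw [e1, e2, mul_comm (μ {ω | W ω ≤ z})]
      exact this)
  simp only [← measureReal_def] at tA tB1 tB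
  rw [hcompl, hcompl] at tA
  have hmono : μ.real {ω | 0 < max (z - W ω) 0} ≤ μ.real {ω | W ω ≤ z} := by
    refine measureReal_mono (fun ω h => ?_)
    simp only [Set.mem_ofPred_eq, lt_max_iff] at h ⊢
    rcases h with h | h <;> linarith
  refine ⟨_, _, integral_nonneg (f := fun ω => max (W ω - z) 0) fun ω => le_max_right _ _,
    integral_nonneg (f := fun ω => max (z - W ω) 0) fun ω => le_max_right _ _, hdiff, hsum, ?_, ?_⟩
  · rw [← hsum2]; nlinarith
  · refine tB1.trans ?_
    have hp : 0 ≤ μ.real {ω | W ω ≤ z} := measureReal_nonneg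
    calc _ ≤ μ.real {ω | W ω ≤ z} * (a * μ.real {ω | W ω ≤ z}) := by gcongr
      _ = _ := by ring

lemma core {Ω : Type*} [MeasurableSpace Ω] (μ : Measure Ω) [IsProbabilityMeasure μ]
    (W : Ω → ℝ) (hW : Measurable W) (hi : Integrable W μ)
    (hi2 : Integrable (fun ω => W ω ^ 2) μ) (h0 : ∫ ω, W ω ∂μ = 0) (h1 : ∫ ω, W ω ^ 2 ∂μ = 1)
    (hF : LC (fun z => μ {ω | W ω ≤ z})) (hS : LC (fun z => μ {ω | z < W ω}))
    (hmed : 1 / 2 ≤ μ.real {ω | W ω ≤ 0}) (t : ℝ) (ht : t ≤ 0) :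
    1 / 2 + t ≤ μ.real {ω | W ω ≤ t} := by
  set F : ℝ → ℝ := fun z => μ.real {ω | W ω ≤ z} with hFdef
  have hF0 : ∀ z, 0 ≤ F z := fun z => measureReal_nonneg
  have hF1 : ∀ z, F z ≤ 1 := fun z => measureReal_le_one
  have step := fun z a ha => step_ineq μ W hW hi hi2 h0 h1 hF hS z a ha
  change ∀ z a, 0 ≤ a → ∃ A B : ℝ, 0 ≤ A ∧ 0 ≤ B ∧ A - B = - z ∧ A + B ≤ 1 + z ^ 2 ∧
      (F z - F (z - a)) * (1 + z ^ 2) ≤ 2 * a * ((1 - F (z - a)) * A + F z * B) ∧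
      (F z - F (z - a)) * B ≤ a * F z ^ 2 at step
  change 1 / 2 ≤ F 0 at hmed
  change 1 / 2 + t ≤ F t
  clear_value F
  have lip : ∀ z a, 0 ≤ a → F z - F (z - a) ≤ 2 * a := by
    intro z a ha
    obtain ⟨A, B, hA, hB, -, hs, hb, -⟩ := step z a ha
    have e : (1 - F (z - a)) * A + F z * B ≤ 1 + z ^ 2 := by
      nlinarith [mul_nonneg (hF0 (z - a)) hA, mul_nonneg (sub_nonneg.2 (hF1 z)) hB]
    have : (F z - F (z - a)) * (1 + z ^ 2) ≤ 2 * a * (1 + z ^ 2) :=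
      hb.trans (mul_le_mul_of_nonneg_left e (by positivity))
    exact le_of_mul_le_mul_right this (by positivity)
  by_contra! hcon
  have ht2 : -1 / 2 < t := by linarith [hF0 t]
  set δ := 1 / 2 + t - F t with hδ
  have hδ0 : 0 < δ := by linarith
  obtain ⟨N, hN⟩ := exists_nat_gt (max (1 / δ) 16)
  have hN1 : 1 / δ < N := (le_max_left _ _).trans_lt hN
  have hN2 : (16 : ℝ) < N := (le_max_right _ _).trans_lt hN
  have hN0 : (0 : ℝ) < N := by linarith
  set a := -t / N with hadef
  have ha0 : 0 ≤ a := div_nonneg (by linarith) hN0.le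
  have haN : N * a = -t := by rw [hadef]; field_simp
  have haδ : a < δ := by
    rw [div_lt_iff₀ hδ0] at hN1
    rw [hadef, div_lt_iff₀ hN0]
    linarith
  have ha16 : a < 1 / 16 := by
    rw [hadef, div_lt_iff₀ hN0]
    linarith
  let D : ℕ → ℝ := fun k => F (t + k * a) - (t + k * a) - 1 / 2
  have hD0 : D 0 = - δ := by simp only [D, hδ]; push_cast; ring_nf
  have hDN : 0 ≤ D N := by
    simp only [D]; rw [haN]; simp; linarith
  have hex : ∃ k, D 0 < D k := ⟨N, by linarith⟩
  classical
  set k := Nat.find hex with hk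
  have hk1 : D 0 < D k := Nat.find_spec hex
  have hk0 : k ≠ 0 := by
    intro h; rw [h] at hk1; exact lt_irrefl _ hk1
  obtain ⟨j, hj⟩ := Nat.exists_eq_succ_of_ne_zero hk0
  have hj1 : D j ≤ D 0 := not_lt.1 (Nat.find_min hex (by omega))
  have hkN : k ≤ N := Nat.find_min' hex (by linarith)
  set z := t + k * a with hz
  have hzj : t + j * a = z - a := by rw [hz, hj]; push_cast; ring
  have hDk : D k = F z - z - 1 / 2 := rfl
  have hDj : D j = F (z - a) - (z - a) - 1 / 2 := by simp only [D, hzj]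
  have hz0 : z ≤ 0 := by
    have : (k : ℝ) ≤ N := by exact_mod_cast hkN
    have := mul_le_mul_of_nonneg_right this ha0
    linarith
  have hl := lip z a ha0
  have hΔ : a < F z - F (z - a) := by linarith
  have hneg : F z < 1 / 2 + z := by linarith
  obtain ⟨A, B, hA, hB, hAB, hs, hb, hB2⟩ := step z a ha0
  have ha : 0 < a := by
    rcases ha0.eq_or_lt with h | h
    · rw [← h] at hΔ; simp at hΔ
    · exact h
  have p0 := hF0 z
  have hBp : B ≤ F z ^ 2 := by
    have : a * B ≤ a * F z ^ 2 := le_trans (mul_le_mul_of_nonneg_right hΔ.le hB) hB2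
    exact le_of_mul_le_mul_left this ha
  have hb' : 1 + z ^ 2 ≤ 2 * ((1 - F (z - a)) * A + F z * B) := by
    have : a * (1 + z ^ 2) ≤ a * (2 * ((1 - F (z - a)) * A + F z * B)) := by
      refine le_trans (mul_le_mul_of_nonneg_right hΔ.le (by positivity)) (hb.trans (le_of_eq ?_))
      ring
    exact le_of_mul_le_mul_left this ha
  have hF4 : F z ^ 2 ≤ 1 / 4 := by
    have : F z ≤ 1 / 2 := by linarith
    calc F z ^ 2 ≤ (1 / 2) ^ 2 := by gcongr
      _ = 1 / 4 := by norm_num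
  have hA1 : A ≤ 1 := by linarith
  have h3 : (1 - F (z - a)) * A ≤ (1 - F z) * A + 2 * a := by
    have : (F z - F (z - a)) * A ≤ 2 * a * 1 := mul_le_mul hl hA1 hA (by positivity)
    linarith
  have hAe : A = -z + B := by linarith
  clear_value z a δ
  have h4 : 1 + z ^ 2 ≤ 2 * ((1 - F z) * (-z) + F z ^ 2) + 4 * a := by
    have : (1 - F z) * A + F z * B = (1 - F z) * (-z) + B := by rw [hAe]; ring
    linarith
  have h5 : F z * z ≤ 0 := mul_nonpos_of_nonneg_of_nonpos p0 hz0
  have h6 : (1 / 2 + F z) ^ 2 ≤ (1 + z) ^ 2 := by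
    apply pow_le_pow_left₀ <;> linarith
  have h7 : F z ^ 2 ≤ F z := by
    have := mul_le_mul_of_nonneg_left (hF1 z) p0
    linarith [sq (F z)]
  have e1 : (1 + z) ^ 2 = 1 + 2 * z + z ^ 2 := by ring
  have e2 : (1 / 2 + F z) ^ 2 = 1 / 4 + F z + F z ^ 2 := by ring
  have e3 : (1 - F z) * (-z) = F z * z - z := by ring
  rw [e1, e2] at h6
  rw [e3] at h4
  linarith

/-- modulus of the characteristic function -/
noncomputable def rr (n : ℕ) (x : ℕ → ℝ) (u : ℝ) : ℝ :=
  ∏ k ∈ Finset.range n, (√(1 + (u * x k) ^ 2))⁻¹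

/-- minus the argument of the characteristic function -/
noncomputable def th (n : ℕ) (x : ℕ → ℝ) (u : ℝ) : ℝ :=
  ∑ k ∈ Finset.range n, (u * x k - Real.arctan (u * x k))

/-- derivative of `th` -/
noncomputable def thd (n : ℕ) (x : ℕ → ℝ) (u : ℝ) : ℝ :=
  ∑ k ∈ Finset.range n, x k * (1 - 1 / (1 + (u * x k) ^ 2))

lemma th_deriv (n : ℕ) (x : ℕ → ℝ) (u : ℝ) : HasDerivAt (th n x) (thd n x u) u := by
  unfold th thd
  refine HasDerivAt.fun_sum fun k _ => ?_
  have h1 : HasDerivAt (fun u : ℝ => u * x k) (x k) u := by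
    simpa using (hasDerivAt_id u).mul_const (x k)
  exact (h1.fun_sub h1.arctan).congr_deriv (by ring)

lemma thd_nonneg (n : ℕ) (x : ℕ → ℝ) (hx : ∀ i, 0 ≤ x i) (u : ℝ) : 0 ≤ thd n x u := by
  refine Finset.sum_nonneg fun k _ => mul_nonneg (hx k) (sub_nonneg.2 ?_)
  rw [div_le_one (by positivity)]
  nlinarith [sq_nonneg (u * x k)]

lemma thd_le (n : ℕ) (x : ℕ → ℝ) (hx : ∀ i, 0 ≤ x i) (u : ℝ) :
    thd n x u ≤ ∑ k ∈ Finset.range n, x k := by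
  refine Finset.sum_le_sum fun k _ => mul_le_of_le_one_right (hx k) ?_
  have : 0 ≤ 1 / (1 + (u * x k) ^ 2) := by positivity
  linarith

lemma thd_pos (n : ℕ) (x : ℕ → ℝ) (hx : ∀ i, 0 ≤ x i) (hp : 0 < ∑ k ∈ Finset.range n, x k)
    (u : ℝ) (hu : 0 < u) : 0 < thd n x u := by
  obtain ⟨k, hk, hk'⟩ : ∃ k ∈ Finset.range n, 0 < x k := by
    by_contra! hcon
    exact absurd (Finset.sum_nonpos hcon) (not_le.2 hp)
  refine Finset.sum_pos' (fun k _ => mul_nonneg (hx k) (sub_nonneg.2 ?_)) ⟨k, hk, ?_⟩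
  · rw [div_le_one (by positivity)]
    nlinarith [sq_nonneg (u * x k)]
  · refine mul_pos hk' (sub_pos.2 ?_)
    rw [div_lt_one (by positivity)]
    have : 0 < (u * x k) ^ 2 := by positivity
    linarith

lemma thd_mono (n : ℕ) (x : ℕ → ℝ) (hx : ∀ i, 0 ≤ x i) (u v : ℝ) (hu : 0 ≤ u) (h : u ≤ v) :
    thd n x u ≤ thd n x v := by
  refine Finset.sum_le_sum fun k _ => ?_
  have := hx k
  gcongr

lemma rr_pos (n : ℕ) (x : ℕ → ℝ) (u : ℝ) : 0 < rr n x u :=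
  Finset.prod_pos fun k _ => by positivity

lemma rr_le_one (n : ℕ) (x : ℕ → ℝ) (u : ℝ) : rr n x u ≤ 1 := by
  refine Finset.prod_le_one (fun k _ => by positivity) fun k _ => ?_
  refine inv_le_one_of_one_le₀ ?_
  rw [Real.one_le_sqrt]
  nlinarith [sq_nonneg (u * x k)]

lemma rr_anti (n : ℕ) (x : ℕ → ℝ) (hx : ∀ i, 0 ≤ x i) (u v : ℝ) (hu : 0 ≤ u) (h : u ≤ v) :
    rr n x v ≤ rr n x u := by
  refine Finset.prod_le_prod (fun k _ => by positivity) fun k _ => ?_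
  have := hx k
  gcongr

lemma rr_diff (n : ℕ) (x : ℕ → ℝ) : Differentiable ℝ (rr n x) := by
  unfold rr
  refine Differentiable.fun_finsetProd fun k _ => ?_
  intro u
  have : (1 + (u * x k) ^ 2) ≠ 0 := by positivity
  refine DifferentiableAt.inv (DifferentiableAt.sqrt (by fun_prop) this) ?_
  positivity

lemma thd_diff (n : ℕ) (x : ℕ → ℝ) : Differentiable ℝ (thd n x) := by
  unfold thd
  refine Differentiable.fun_sum fun k _ => ?_
  intro u
  have : (1 + (u * x k) ^ 2) ≠ 0 := by positivity
  fun_prop (disch := assumption)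

lemma arctan_ge (y : ℝ) (hy : 0 ≤ y) : y / (1 + y ^ 2) ≤ Real.arctan y := by
  have h1 : Real.sin (Real.arctan y) ≤ Real.arctan y :=
    Real.sin_le (Real.arctan_nonneg.2 hy)
  have h2 : y / (1 + y ^ 2) ≤ Real.sin (Real.arctan y) := by
    rw [Real.sin_arctan]
    gcongr
    rw [Real.sqrt_le_left (by positivity)]
    nlinarith [sq_nonneg y, sq_nonneg (y ^ 2)]
  exact h2.trans h1

lemma th_le (n : ℕ) (x : ℕ → ℝ) (hx : ∀ i, 0 ≤ x i) (u : ℝ) (hu : 0 ≤ u) :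
    th n x u ≤ u * thd n x u := by
  unfold th thd
  rw [Finset.mul_sum]
  refine Finset.sum_le_sum fun k _ => ?_
  have := arctan_ge (u * x k) (mul_nonneg hu (hx k))
  have e : u * (x k * (1 - 1 / (1 + (u * x k) ^ 2))) = u * x k - u * x k / (1 + (u * x k) ^ 2) := by
    ring
  rw [e]; linarith

lemma th_nonneg (n : ℕ) (x : ℕ → ℝ) (hx : ∀ i, 0 ≤ x i) (u : ℝ) (hu : 0 ≤ u) :
    0 ≤ th n x u := by
  refine Finset.sum_nonneg fun k _ => ?_
  have := Real.le_tan (Real.arctan_nonneg.2 (mul_nonneg hu (hx k))) (Real.arctan_lt_pi_div_two _)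
  rw [Real.tan_arctan] at this
  linarith

lemma osc_interval (n : ℕ) (x : ℕ → ℝ) (hx : ∀ i, 0 ≤ x i)
    (hp : 0 < ∑ k ∈ Finset.range n, x k) (ε : ℝ) (hε : 0 < ε) (U : ℝ) (hU : 0 ≤ U) :
    0 ≤ ∫ u in (0 : ℝ)..U, Real.exp (-(ε * u)) * (rr n x u * Real.sin (th n x u)) := by
  set q : ℝ → ℝ := fun u => Real.exp (-(ε * u)) * rr n x u / thd n x u with hq
  set K : ℝ → ℝ := fun u => (1 - Real.cos (th n x u)) * q u with hK
  have hthc : Continuous (th n x) :=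
    continuous_iff_continuousAt.2 fun u => (th_deriv n x u).continuousAt
  have hqd : ∀ u, 0 < u → DifferentiableAt ℝ q u := by
    intro u hu
    have h1 := (rr_diff n x) u
    have h2 := (thd_diff n x) u
    exact DifferentiableAt.div (by fun_prop) h2 (thd_pos n x hx hp u hu).ne'
  have hqn : ∀ u, 0 ≤ q u := fun u =>
    div_nonneg (mul_nonneg (Real.exp_nonneg _) (rr_pos n x u).le) (thd_nonneg n x hx u)
  have hqa : AntitoneOn q (Set.Ioi 0) := by
    intro u hu v hv huv
    have hu : 0 < u := hu
    have h1 := rr_anti n x hx u v hu.le huv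
    have h2 := thd_mono n x hx u v hu.le huv
    have h3 := thd_pos n x hx hp u hu
    have h4 := rr_pos n x v
    have h5 := rr_pos n x u
    simp only [hq]
    have : 0 ≤ Real.exp (-(ε * u)) * rr n x u := by positivity
    gcongr
  have hq' : ∀ u, 0 < u → deriv q u ≤ 0 := by
    intro u hu
    have := hqa.derivWithin_nonpos (x := u)
    rwa [derivWithin_of_isOpen isOpen_Ioi hu] at this
  have hKd : ∀ u, 0 < u → HasDerivAt K
      (Real.sin (th n x u) * thd n x u * q u + (1 - Real.cos (th n x u)) * deriv q u) u := by
    intro u hu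
    have h1 := ((th_deriv n x u).cos.const_sub 1).mul (hqd u hu).hasDerivAt
    exact h1.congr_deriv (by ring)
  have hK0 : ∀ u, 0 ≤ K u := fun u => mul_nonneg (by linarith [Real.cos_le_one (th n x u)]) (hqn u)
  have hKle : ∀ u, 0 ≤ u → K u ≤ u ^ 2 * ∑ k ∈ Finset.range n, x k := by
    intro u hu
    rcases hu.eq_or_lt with rfl | hu
    · simp [hK, hq, thd]
    have h1 : 1 - Real.cos (th n x u) ≤ th n x u ^ 2 / 2 := by
      linarith [Real.one_sub_sq_div_two_le_cos (x := th n x u)]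
    have h2 := th_le n x hx u hu.le
    have h3 := th_nonneg n x hx u hu.le
    have h4 := thd_pos n x hx hp u hu
    have h5 : q u ≤ 1 / thd n x u := by
      simp only [hq]
      gcongr
      refine mul_le_one₀ ?_ (rr_pos n x u).le (rr_le_one n x u)
      rw [Real.exp_le_one_iff]; nlinarith
    have h6 : 1 - Real.cos (th n x u) ≤ (u * thd n x u) ^ 2 := by
      have : th n x u ^ 2 ≤ (u * thd n x u) ^ 2 := by gcongr
      nlinarith [sq_nonneg (th n x u)]
    calc K u ≤ (u * thd n x u) ^ 2 * (1 / thd n x u) :=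
          mul_le_mul h6 h5 (hqn u) (by positivity)
      _ = u ^ 2 * thd n x u := by field_simp
      _ ≤ _ := by gcongr; exact thd_le n x hx u
  have hKz : K 0 = 0 := le_antisymm (by simpa using hKle 0 le_rfl) (hK0 0)
  have hcont : ContinuousOn K (Set.Icc 0 U) := by
    intro u hu
    rcases hu.1.eq_or_lt with h | h
    · subst h
      have h1 : Filter.Tendsto K (𝓝[Set.Icc 0 U] 0) (𝓝 0) := by
        have h2 : Filter.Tendsto (fun u : ℝ => u ^ 2 * ∑ k ∈ Finset.range n, x k)
            (𝓝[Set.Icc 0 U] 0) (𝓝 0) := by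
          have : Continuous (fun u : ℝ => u ^ 2 * ∑ k ∈ Finset.range n, x k) := by fun_prop
          have := (this.tendsto 0).mono_left (nhdsWithin_le_nhds (s := Set.Icc 0 U))
          simpa using this
        refine tendsto_of_tendsto_of_tendsto_of_le_of_le' tendsto_const_nhds h2
          (Filter.Eventually.of_forall hK0) ?_
        filter_upwards [self_mem_nhdsWithin] with u hu using hKle u hu.1
      unfold ContinuousWithinAt
      rwa [hKz]
    · exact (hKd u h).continuousAt.continuousWithinAt
  have hci : Continuous (fun u => Real.exp (-(ε * u)) * (rr n x u * Real.sin (th n x u))) := by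
    have := (rr_diff n x).continuous
    fun_prop
  have := intervalIntegral.sub_le_integral_of_hasDeriv_right_of_le hU hcont
    (fun u hu => (hKd u hu.1).hasDerivWithinAt) (hci.integrableOn_Icc) (fun u hu => by
      have h1 := thd_pos n x hx hp u hu.1
      have h2 : Real.sin (th n x u) * thd n x u * q u =
          Real.exp (-(ε * u)) * (rr n x u * Real.sin (th n x u)) := by
        simp only [hq]; field_simp
      rw [h2]
      have h3 : (1 - Real.cos (th n x u)) * deriv q u ≤ 0 :=
        mul_nonpos_of_nonneg_of_nonpos (by linarith [Real.cos_le_one (th n x u)]) (hq' u hu.1)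
      linarith)
  rw [hKz] at this
  linarith [hK0 U]

lemma osc (n : ℕ) (x : ℕ → ℝ) (hx : ∀ i, 0 ≤ x i)
    (hp : 0 < ∑ k ∈ Finset.range n, x k) (ε : ℝ) (hε : 0 < ε) :
    0 ≤ ∫ u in Set.Ioi (0 : ℝ), Real.exp (-(ε * u)) * (rr n x u * Real.sin (th n x u)) := by
  have hci : Continuous (fun u => Real.exp (-(ε * u)) * (rr n x u * Real.sin (th n x u))) := by
    have := (rr_diff n x).continuous
    have hthc : Continuous (th n x) :=
      continuous_iff_continuousAt.2 fun u => (th_deriv n x u).continuousAt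
    fun_prop
  have hIntg : IntegrableOn (fun u => Real.exp (-(ε * u)) * (rr n x u * Real.sin (th n x u)))
      (Set.Ioi 0) := by
    have h1 : IntegrableOn (fun u => Real.exp (-(ε * u))) (Set.Ioi 0) := by
      simpa using exp_neg_integrableOn_Ioi 0 hε
    refine Integrable.mono' h1 hci.aestronglyMeasurable (ae_of_all _ fun u => ?_)
    rw [norm_mul, Real.norm_of_nonneg (Real.exp_nonneg _), norm_mul,
      Real.norm_of_nonneg (rr_pos n x u).le]
    refine mul_le_of_le_one_right (Real.exp_nonneg _) ?_
    exact mul_le_one₀ (rr_le_one n x u) (norm_nonneg _) (Real.abs_sin_le_one _)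
  refine ge_of_tendsto (intervalIntegral_tendsto_integral_Ioi 0 hIntg Filter.tendsto_id) ?_
  filter_upwards [Filter.eventually_ge_atTop 0] with U hU
  exact osc_interval n x hx hp ε hε U hU

lemma integral_exp_sin (ε : ℝ) (hε : 0 < ε) (w : ℝ) :
    ∫ u in Set.Ioi (0 : ℝ), Real.exp (-(ε * u)) * Real.sin (u * w) = w / (w ^ 2 + ε ^ 2) := by
  have hre : (-(ε : ℂ) + w * Complex.I).re < 0 := by simp [hε]
  have h := integral_exp_mul_complex_Ioi hre 0
  have hi := integrableOn_exp_mul_complex_Ioi hre 0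
  have h2 : ∫ u in Set.Ioi (0 : ℝ), Real.exp (-(ε * u)) * Real.sin (u * w) =
      (∫ u in Set.Ioi (0 : ℝ), Complex.exp ((-(ε : ℂ) + w * Complex.I) * u)).im := by
    rw [← RCLike.im_to_complex, ← integral_im hi]
    congr 1; ext u
    rw [RCLike.im_to_complex, Complex.exp_im]
    simp
    ring_nf
  rw [h2, h]
  simp [Complex.div_im, Complex.normSq_apply]
  ring

lemma stieltjes_nonpos {Ω : Type*} [MeasurableSpace Ω] (μ : Measure Ω) [IsProbabilityMeasure μ]
    (W : Ω → ℝ) (hW : Measurable W) (φ : ℝ → ℝ)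
    (hφ : ∀ u, 0 < u → ∫ ω, Real.sin (u * W ω) ∂μ = - φ u) (ε : ℝ) (hε : 0 < ε)
    (hosc : 0 ≤ ∫ u in Set.Ioi (0 : ℝ), Real.exp (-(ε * u)) * φ u) :
    ∫ ω, W ω / (W ω ^ 2 + ε ^ 2) ∂μ ≤ 0 := by
  simp only [← integral_exp_sin ε hε]
  rw [integral_integral_swap]
  · have : ∫ u in Set.Ioi (0 : ℝ), ∫ ω, Real.exp (-(ε * u)) * Real.sin (u * W ω) ∂μ =
        ∫ u in Set.Ioi (0 : ℝ), -(Real.exp (-(ε * u)) * φ u) := by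
      refine setIntegral_congr_fun measurableSet_Ioi fun u hu => ?_
      rw [integral_const_mul, hφ u hu]; ring
    rw [this, integral_neg]
    linarith
  · have h1 : IntegrableOn (fun u => Real.exp (-(ε * u))) (Set.Ioi 0) := by
      simpa using exp_neg_integrableOn_Ioi 0 hε
    have h2 : Integrable (fun z : Ω × ℝ => (1 : ℝ) * Real.exp (-(ε * z.2)))
        (μ.prod (volume.restrict (Set.Ioi 0))) := (integrable_const (1 : ℝ)).mul_prod h1
    refine h2.mono' (Measurable.aestronglyMeasurable ?_) (ae_of_all _ fun z => ?_)
    · unfold Function.uncurry; fun_prop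
    · simp only [Function.uncurry, norm_mul, one_mul]
      rw [Real.norm_of_nonneg (Real.exp_nonneg _)]
      exact mul_le_of_le_one_right (Real.exp_nonneg _) (Real.abs_sin_le_one _)

lemma arctan_nonpos {Ω : Type*} [MeasurableSpace Ω] (μ : Measure Ω) [IsProbabilityMeasure μ]
    (W : Ω → ℝ) (hW : Measurable W)
    (h : ∀ ε : ℝ, 0 < ε → ∫ ω, W ω / (W ω ^ 2 + ε ^ 2) ∂μ ≤ 0) (N : ℝ) (hN : 1 ≤ N) :
    ∫ ω, (Real.arctan (N * W ω) - Real.arctan (W ω / N)) ∂μ ≤ 0 := by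
  have hN0 : 0 < N := by linarith
  have hle : N⁻¹ ≤ N := (inv_le_one_of_one_le₀ hN).trans hN
  have key : ∀ w : ℝ, Real.arctan (N * w) - Real.arctan (w / N) =
      ∫ ε in Set.Ioc N⁻¹ N, w / (w ^ 2 + ε ^ 2) := by
    intro w
    rw [← intervalIntegral.integral_of_le hle]
    have hpos : ∀ ε ∈ Set.uIcc N⁻¹ N, 0 < ε := by
      intro ε hε
      rw [Set.uIcc_of_le hle] at hε
      exact lt_of_lt_of_le (by positivity) hε.1
    have hd : ∀ ε ∈ Set.uIcc N⁻¹ N,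
        HasDerivAt (fun ε => - Real.arctan (w / ε)) (w / (w ^ 2 + ε ^ 2)) ε := by
      intro ε hε
      have h0 := hpos ε hε
      have h1 : HasDerivAt (fun ε : ℝ => w / ε) (-w / ε ^ 2) ε := by
        have := (hasDerivAt_inv h0.ne').const_mul w
        simp only [div_eq_mul_inv]
        exact this.congr_deriv (by ring)
      refine h1.arctan.neg.congr_deriv ?_
      field_simp
      ring
    rw [intervalIntegral.integral_eq_sub_of_hasDerivAt hd]
    · simp; rw [mul_comm]; ring
    · refine ContinuousOn.intervalIntegrable fun ε hε => ContinuousAt.continuousWithinAt ?_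
      have h0 := hpos ε hε
      have : w ^ 2 + ε ^ 2 ≠ 0 := by positivity
      fun_prop (disch := assumption)
  simp only [key]
  rw [integral_integral_swap]
  · refine setIntegral_nonpos measurableSet_Ioc fun ε hε => h ε ?_
    exact lt_trans (by positivity) hε.1
  · have hs : ∀ᵐ z ∂(μ.prod (volume.restrict (Set.Ioc N⁻¹ N))), z.2 ∈ Set.Ioc N⁻¹ N := by
      refine Measure.quasiMeasurePreserving_snd.ae (ae_restrict_mem measurableSet_Ioc)
    have h2 : Integrable (fun z : Ω × ℝ => N)
        (μ.prod (volume.restrict (Set.Ioc N⁻¹ N))) := integrable_const _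
    refine h2.mono' (Measurable.aestronglyMeasurable ?_) ?_
    · unfold Function.uncurry; fun_prop
    · filter_upwards [hs] with z hz
      simp only [Function.uncurry]
      have h0 : 0 < N⁻¹ := by positivity
      have hz0 : 0 < z.2 := h0.trans hz.1
      rw [norm_div, Real.norm_of_nonneg (by positivity : 0 ≤ W z.1 ^ 2 + z.2 ^ 2), Real.norm_eq_abs,
        div_le_iff₀ (by positivity)]
      have h1 : |W z.1| * z.2 ≤ W z.1 ^ 2 + z.2 ^ 2 := by
        rw [← sq_abs (W z.1)]; nlinarith [sq_nonneg (|W z.1| - z.2), abs_nonneg (W z.1), hz0.le,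
          sq_nonneg (|W z.1|), sq_nonneg z.2]
      have h2 : 1 ≤ N * z.2 := by
        have := mul_le_mul_of_nonneg_left hz.1.le hN0.le
        rwa [mul_inv_cancel₀ hN0.ne'] at this
      calc |W z.1| ≤ |W z.1| * (N * z.2) := le_mul_of_one_le_right (abs_nonneg _) h2
        _ = N * (|W z.1| * z.2) := by ring
        _ ≤ _ := by gcongr

lemma median {Ω : Type*} [MeasurableSpace Ω] (μ : Measure Ω) [IsProbabilityMeasure μ]
    (W : Ω → ℝ) (hW : Measurable W)
    (h : ∀ ε : ℝ, 0 < ε → ∫ ω, W ω / (W ω ^ 2 + ε ^ 2) ∂μ ≤ 0) :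
    1 / 2 ≤ μ.real {ω | W ω ≤ 0} := by
  have hlim : Filter.Tendsto (fun N : ℕ => ∫ ω, (Real.arctan (((N : ℝ) + 1) * W ω)
      - Real.arctan (W ω / ((N : ℝ) + 1))) ∂μ) Filter.atTop
      (𝓝 (∫ ω, (Real.pi / 2) * (SignType.sign (W ω) : ℝ) ∂μ)) := by
    refine tendsto_integral_of_dominated_convergence (fun _ => Real.pi) (fun N => ?_)
      (integrable_const _) (fun N => ae_of_all _ fun ω => ?_) (ae_of_all _ fun ω => ?_)
    · exact (by fun_prop : Measurable _).aestronglyMeasurable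
    · rw [Real.norm_eq_abs, abs_le]
      constructor <;> linarith [Real.arctan_lt_pi_div_two (((N : ℝ) + 1) * W ω),
        Real.arctan_lt_pi_div_two (W ω / ((N : ℝ) + 1)),
        Real.neg_pi_div_two_lt_arctan (((N : ℝ) + 1) * W ω),
        Real.neg_pi_div_two_lt_arctan (W ω / ((N : ℝ) + 1))]
    · have hN : Filter.Tendsto (fun N : ℕ => (N : ℝ) + 1) Filter.atTop Filter.atTop :=
        Filter.tendsto_atTop_add_const_right _ _ tendsto_natCast_atTop_atTop
      have h2 : Filter.Tendsto (fun N : ℕ => Real.arctan (W ω / ((N : ℝ) + 1))) Filter.atTop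
          (𝓝 0) := by
        have := (Real.continuous_arctan.tendsto 0).comp (hN.const_div_atTop (W ω))
        simpa [Function.comp_def] using this
      have h1 : Filter.Tendsto (fun N : ℕ => Real.arctan (((N : ℝ) + 1) * W ω)) Filter.atTop
          (𝓝 ((Real.pi / 2) * (SignType.sign (W ω) : ℝ))) := by
        rcases lt_trichotomy (W ω) 0 with hw | hw | hw
        · have := Real.tendsto_arctan_atBot.comp (hN.atTop_mul_const_of_neg hw)
          have := this.mono_right nhdsWithin_le_nhds
          simpa [hw, Function.comp_def] using this
        · simp [hw]
        · have := Real.tendsto_arctan_atTop.comp (hN.atTop_mul_const hw)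
          have := this.mono_right nhdsWithin_le_nhds
          simpa [hw, Function.comp_def] using this
      simpa using h1.sub h2
  have hle : ∫ ω, (Real.pi / 2) * (SignType.sign (W ω) : ℝ) ∂μ ≤ 0 :=
    le_of_tendsto' hlim fun N => arctan_nonpos μ W hW h _ (by linarith [N.cast_nonneg (α := ℝ)])
  have hms : MeasurableSet {ω | W ω ≤ 0} := measurableSet_le hW measurable_const
  have hI : Integrable (fun ω => {ω | W ω ≤ 0}.indicator (fun _ => (2 : ℝ)) ω) μ :=
    (integrable_const _).indicator hms
  have hge : ∫ ω, (Real.pi / 2) * (1 - {ω | W ω ≤ 0}.indicator (fun _ => (2 : ℝ)) ω) ∂μ ≤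
      ∫ ω, (Real.pi / 2) * (SignType.sign (W ω) : ℝ) ∂μ := by
    refine integral_mono (((integrable_const _).sub hI).const_mul _) ?_ fun ω => ?_
    · refine (integrable_const (Real.pi / 2)).mono' ?_ (ae_of_all _ fun ω => ?_)
      · have : Measurable (fun y : ℝ => (SignType.sign y : ℝ)) := by
          have e : (fun y : ℝ => (SignType.sign y : ℝ)) =
              fun y => if 0 < y then (1 : ℝ) else if y < 0 then -1 else 0 := by
            ext y
            rcases lt_trichotomy y 0 with hw | hw | hw
            · simp [hw, hw.le, not_lt.2 hw.le]
            · simp [hw]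
            · simp [hw]
          rw [e]
          exact Measurable.ite measurableSet_Ioi measurable_const
            (Measurable.ite measurableSet_Iio measurable_const measurable_const)
        exact ((this.comp hW).const_mul _).aestronglyMeasurable
      · rw [norm_mul, Real.norm_of_nonneg (by positivity)]
        refine mul_le_of_le_one_right (by positivity) ?_
        rcases lt_trichotomy (W ω) 0 with hw | hw | hw <;> simp [hw]
    · have := Real.pi_pos
      simp only
      gcongr
      by_cases hw : W ω ≤ 0
      · simp only [Set.indicator, Set.mem_ofPred_eq, hw, if_true]
        rcases hw.lt_or_eq with hw | hw <;> simp [hw]; norm_num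
      · simp only [Set.indicator, Set.mem_ofPred_eq, hw, if_false]
        simp [not_le.1 hw]
  rw [integral_const_mul, integral_sub (integrable_const _) hI, integral_indicator_const _ hms]
    at hge
  simp only [integral_const, probReal_univ, smul_eq_mul] at hge
  have := Real.pi_pos
  nlinarith
lemma exp_eq_withDensity : expMeasure 1 =
    (volume.restrict (Set.Ioi (0 : ℝ))).withDensity (fun s => ENNReal.ofReal (Real.exp (-s))) := by
  ext A hA
  rw [← lintegral_indicator_one hA, lintegral_expMeasure, withDensity_apply _ hA,
    setLIntegral_congr Ioi_ae_eq_Ici.symm, ← lintegral_indicator hA]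
  refine lintegral_congr fun s => ?_
  by_cases h : s ∈ A <;> simp [h]

lemma exp_integrable_iff {E : Type*} [NormedAddCommGroup E] [NormedSpace ℝ E] (g : ℝ → E) :
    Integrable g (expMeasure 1) ↔ IntegrableOn (fun s => Real.exp (-s) • g s) (Set.Ioi 0) := by
  rw [exp_eq_withDensity, integrable_withDensity_iff_integrable_smul' (by fun_prop)
    (ae_of_all _ fun s => by simp)]
  simp only [ENNReal.toReal_ofReal (Real.exp_pos _).le]
  rfl

lemma exp_integral {E : Type*} [NormedAddCommGroup E] [NormedSpace ℝ E] (g : ℝ → E) :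
    ∫ s, g s ∂expMeasure 1 = ∫ s in Set.Ioi 0, Real.exp (-s) • g s := by
  rw [exp_eq_withDensity, integral_withDensity_eq_integral_toReal_smul (by fun_prop)
    (ae_of_all _ fun s => by simp)]
  simp only [ENNReal.toReal_ofReal (Real.exp_pos _).le]

lemma exp_pow_integrable (k : ℕ) : Integrable (fun s : ℝ => s ^ k) (expMeasure 1) := by
  rw [exp_integrable_iff]
  have h := Real.GammaIntegral_convergent (s := (k : ℝ) + 1) (by positivity)
  simpa using h

lemma exp_pow_integral (k : ℕ) : ∫ s : ℝ, s ^ k ∂expMeasure 1 = k.factorial := by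
  rw [exp_integral, ← Real.Gamma_nat_eq_factorial, Real.Gamma_eq_integral (by positivity)]
  simp

lemma exp_char (y : ℝ) : ∫ s : ℝ, Complex.exp (Complex.I * (y * (s - 1) : ℝ)) ∂expMeasure 1 =
    ((√(1 + y ^ 2))⁻¹ : ℝ) * Complex.exp (-Complex.I * ((y - Real.arctan y : ℝ) : ℂ)) := by
  have h1 : ∀ s : ℝ, Real.exp (-s) • Complex.exp (Complex.I * (y * (s - 1) : ℝ)) =
      Complex.exp (-Complex.I * y) * Complex.exp ((-1 + Complex.I * y) * s) := by
    intro s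
    rw [Complex.real_smul, Complex.ofReal_exp, ← Complex.exp_add, ← Complex.exp_add]
    congr 1; push_cast; ring
  rw [exp_integral]
  simp only [h1]
  rw [integral_const_mul, integral_exp_mul_complex_Ioi (by simp)]
  have h2 : -Complex.I * ((y - Real.arctan y : ℝ) : ℂ) =
    -Complex.I * y + (Real.arctan y : ℂ) * Complex.I := by push_cast; ring
  rw [h2, Complex.exp_add, Complex.exp_mul_I, ← Complex.ofReal_cos, ← Complex.ofReal_sin,
    Real.cos_arctan, Real.sin_arctan]
  have hs : 0 < √(1 + y ^ 2) := by positivity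
  have hsq : √(1 + y ^ 2) ^ 2 = 1 + y ^ 2 := Real.sq_sqrt (by positivity)
  have hne : (-1 + Complex.I * y) ≠ 0 := by
    intro h; have := congrArg Complex.re h; simp at this
  have hne2 : ((√(1 + y ^ 2) : ℝ) : ℂ) ≠ 0 := by exact_mod_cast hs.ne'
  have hsq' : ((√(1 + y ^ 2) : ℝ) : ℂ) ^ 2 = 1 + (y : ℂ) ^ 2 := by exact_mod_cast hsq
  have : -Complex.exp ((-1 + Complex.I * y) * (0 : ℝ)) / (-1 + Complex.I * y) =
     ((√(1 + y ^ 2))⁻¹ : ℝ) * (((1 / √(1 + y ^ 2) : ℝ) : ℂ) + ((y / √(1 + y ^ 2) : ℝ) : ℂ) * Complex.I) := by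
    push_cast
    simp only [mul_zero, Complex.exp_zero]
    rw [div_eq_iff hne]
    field_simp
    rw [hsq']
    linear_combination (- (y:ℂ) ^ 2) * Complex.I_sq
  rw [this]; ring

lemma exp_nonneg_ae : ∀ᵐ s ∂expMeasure 1, 0 ≤ s := by
  rw [exp_eq_withDensity]
  refine (withDensity_absolutelyContinuous _ _).ae_le ?_
  filter_upwards [ae_restrict_mem measurableSet_Ioi] with s hs using le_of_lt hs

lemma pi_eq (ν : Measure (ℕ → ℝ)) (hν : IsPiNat (fun _ => expMeasure 1) ν) :
    iIndepFun (fun (i : ℕ) (s : ℕ → ℝ) => s i) ν ∧ ∀ i, ν.map (fun s => s i) = expMeasure 1 := by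
  have : IsProbabilityMeasure (expMeasure 1) := isProbabilityMeasure_expMeasure one_pos
  have h : ν = Measure.infinitePi (fun _ : ℕ => expMeasure 1) :=
    Measure.eq_infinitePi _ fun s t ht => by
      rw [← hν.2 s t ht]; rfl
  rw [h]
  exact ⟨iIndepFun_infinitePi (X := fun _ ω => ω) (by fun_prop),
    fun i => Measure.infinitePi_map_eval _ i⟩

/-- partial sums -/
noncomputable def XX (n : ℕ) (x : ℕ → ℝ) (s : ℕ → ℝ) : ℝ := ∑ k ∈ Finset.range n, x k * s k

lemma XX_meas (n : ℕ) (x : ℕ → ℝ) : Measurable (XX n x) := by unfold XX; fun_prop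

lemma XX_indep (ν : Measure (ℕ → ℝ)) (hi : iIndepFun (fun (i : ℕ) (s : ℕ → ℝ) => s i) ν)
    (n : ℕ) (x : ℕ → ℝ) : IndepFun (XX n x) (fun s => s n) ν := by
  have h := hi.indepFun_finset (Finset.range n) {n} (by simp) (fun i => by fun_prop)
  have hψ : Measurable (fun a : ({n} : Finset ℕ) → ℝ => a ⟨n, by simp⟩) := measurable_pi_apply _
  have hφ : Measurable (fun a : (Finset.range n) → ℝ => ∑ k : Finset.range n, x k * a k) := by
    fun_prop
  have h2 := h.comp hφ hψ
  have he : XX n x = (fun a : (Finset.range n) → ℝ => ∑ k : Finset.range n, x k * a k) ∘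
      fun (a : ℕ → ℝ) (i : Finset.range n) => a i := by
    ext s
    simp only [XX, Function.comp]
    exact (Finset.sum_coe_sort (Finset.range n) (fun k => x k * s k)).symm
  rw [he]
  exact h2

lemma XX_step (ν : Measure (ℕ → ℝ)) [IsProbabilityMeasure ν]
    (hi : iIndepFun (fun (i : ℕ) (s : ℕ → ℝ) => s i) ν)
    (hl : ∀ i, ν.map (fun s => s i) = expMeasure 1) (n : ℕ) (x : ℕ → ℝ) (A : Set ℝ)
    (hA : MeasurableSet A) :
    ν {s | XX (n + 1) x s ∈ A} = ∫⁻ r, ν {s | XX n x s + x n * r ∈ A} ∂expMeasure 1 := by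
  have : IsProbabilityMeasure (expMeasure 1) := isProbabilityMeasure_expMeasure one_pos
  have : IsProbabilityMeasure (ν.map (XX n x)) :=
    Measure.isProbabilityMeasure_map (XX_meas n x).aemeasurable
  have h := (indepFun_iff_map_prod_eq_prod_map_map (XX_meas n x).aemeasurable
    (measurable_pi_apply n).aemeasurable).1 (XX_indep ν hi n x)
  rw [hl n] at h
  have hB : MeasurableSet {p : ℝ × ℝ | p.1 + x n * p.2 ∈ A} :=
    hA.preimage (by fun_prop)
  have h1 : ν {s | XX (n + 1) x s ∈ A} =
      ν.map (fun s => (XX n x s, s n)) {p : ℝ × ℝ | p.1 + x n * p.2 ∈ A} := by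
    rw [Measure.map_apply ((XX_meas n x).prodMk (by fun_prop)) hB]
    congr 1
    ext s
    simp [XX, Finset.sum_range_succ]
  rw [h1, h, Measure.prod_apply_symm hB]
  refine lintegral_congr fun r => ?_
  rw [Measure.map_apply (XX_meas n x) (hB.preimage (by fun_prop))]
  rfl

lemma XX_LC_le (ν : Measure (ℕ → ℝ)) [IsProbabilityMeasure ν]
    (hi : iIndepFun (fun (i : ℕ) (s : ℕ → ℝ) => s i) ν)
    (hl : ∀ i, ν.map (fun s => s i) = expMeasure 1) (x : ℕ → ℝ) (hx : ∀ i, 0 ≤ x i) (n : ℕ) :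
    LC (fun z => ν {s | XX n x s ≤ z}) := by
  induction n with
  | zero =>
    intro z w a hzw ha
    by_cases h1 : 0 ≤ z - a
    · have h2 : 0 ≤ w := by linarith
      have h3 : 0 ≤ w - a := by linarith
      have h4 : 0 ≤ z := by linarith
      have h5 : a ≤ w := by linarith
      have h6 : a ≤ z := by linarith
      simp [XX, h2, h4, h5, h6]
    · have h6 : ¬ a ≤ z := by linarith
      simp [XX, h6]
  | succ n ih =>
    have hm : Measurable (fun z => ν {s | XX n x s ≤ z}) :=
      Monotone.measurable fun a b h => measure_mono fun s hs => le_trans hs h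
    have h := LC_conv _ ih hm (x n) (hx n)
    convert h using 2 with z
    have := XX_step ν hi hl n x (Set.Iic z) measurableSet_Iic
    simp only [Set.mem_Iic] at this
    rw [this]
    simp only [le_sub_iff_add_le]

lemma XX_LC_lt (ν : Measure (ℕ → ℝ)) [IsProbabilityMeasure ν]
    (hi : iIndepFun (fun (i : ℕ) (s : ℕ → ℝ) => s i) ν)
    (hl : ∀ i, ν.map (fun s => s i) = expMeasure 1) (x : ℕ → ℝ) (hx : ∀ i, 0 ≤ x i) (n : ℕ) :
    LC (fun z => ν {s | z < XX n x s}) := by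
  induction n with
  | zero =>
    intro z w a hzw ha
    by_cases h1 : w < 0
    · have h2 : z < 0 := by linarith
      have h5 : w < a := by linarith
      have h6 : z < a := by linarith
      simp [XX, h1, h2, h5, h6]
    · simp [XX, h1]
  | succ n ih =>
    have hm : Measurable (fun z => ν {s | z < XX n x s}) :=
      Antitone.measurable fun a b h => measure_mono fun s hs => lt_of_le_of_lt h hs
    have h := LC_conv _ ih hm (x n) (hx n)
    convert h using 2 with z
    have := XX_step ν hi hl n x (Set.Ioi z) measurableSet_Ioi
    simp only [Set.mem_Ioi] at this
    rw [this]
    simp only [sub_lt_iff_lt_add]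

lemma LC_affine (K : ℝ → ℝ≥0∞) (hK : LC K) (σ m : ℝ) (hσ : 0 ≤ σ) :
    LC (fun z => K (m + σ * z)) := by
  intro z w a hzw ha
  have := hK (m + σ * z) (m + σ * w) (σ * a) (by gcongr) (by positivity)
  simpa [mul_sub, add_sub_assoc] using this

lemma XX_char (ν : Measure (ℕ → ℝ)) [IsProbabilityMeasure ν]
    (hi : iIndepFun (fun (i : ℕ) (s : ℕ → ℝ) => s i) ν)
    (hl : ∀ i, ν.map (fun s => s i) = expMeasure 1) (x : ℕ → ℝ) (n : ℕ) (u : ℝ) :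
    ∫ s, Complex.exp (Complex.I * (u * (XX n x s - ∑ k ∈ Finset.range n, x k) : ℝ)) ∂ν =
      rr n x u * Complex.exp (-Complex.I * th n x u) := by
  have hf : ∀ i, Measurable (fun r : ℝ => Complex.exp (Complex.I * (u * x i * (r - 1) : ℝ))) :=
    fun i => by fun_prop
  have h1 := hi.comp (fun i r => Complex.exp (Complex.I * (u * x i * (r - 1) : ℝ))) hf
  have h2 := (h1.precomp (Fin.val_injective (n := n))).integral_fun_prod_eq_prod_integral
    (fun i => ((hf i).comp (measurable_pi_apply _)).aestronglyMeasurable)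
  have h3 : ∀ i, ∫ s, Complex.exp (Complex.I * (u * x i * (s i - 1) : ℝ)) ∂ν =
    ((√(1 + (u * x i) ^ 2))⁻¹ : ℝ) *
      Complex.exp (-Complex.I * ((u * x i - Real.arctan (u * x i) : ℝ) : ℂ)) := by
    intro i
    rw [← exp_char, ← hl i, integral_map (measurable_pi_apply i).aemeasurable (hf i).aestronglyMeasurable]
  simp only [Function.comp] at h2
  have h4 : ∀ s : ℕ → ℝ, Complex.exp (Complex.I * (u * (XX n x s - ∑ k ∈ Finset.range n, x k) : ℝ))
     = ∏ i : Fin n, Complex.exp (Complex.I * (u * x i * (s i - 1) : ℝ)) := by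
    intro s
    rw [← Complex.exp_sum, Fin.sum_univ_eq_sum_range
      (fun i => Complex.I * ((u * x i * (s i - 1) : ℝ) : ℂ)), XX, ← Finset.sum_sub_distrib,
      Finset.mul_sum, Complex.ofReal_sum, Finset.mul_sum]
    congr 1
    refine Finset.sum_congr rfl fun k _ => ?_
    push_cast; ring
  simp only [h4]
  rw [h2]
  simp only [h3]
  rw [Finset.prod_mul_distrib, ← Complex.exp_sum, rr, th,
    Fin.prod_univ_eq_prod_range (fun i => (((√(1 + (u * x i) ^ 2))⁻¹ : ℝ) : ℂ)),
    Fin.sum_univ_eq_sum_range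
      (fun i => -Complex.I * ((u * x i - Real.arctan (u * x i) : ℝ) : ℂ)),
    Complex.ofReal_prod, Complex.ofReal_sum, Finset.mul_sum]

lemma XX_sin (ν : Measure (ℕ → ℝ)) [IsProbabilityMeasure ν]
    (hi : iIndepFun (fun (i : ℕ) (s : ℕ → ℝ) => s i) ν)
    (hl : ∀ i, ν.map (fun s => s i) = expMeasure 1) (x : ℕ → ℝ) (n : ℕ) (u : ℝ) :
    ∫ s, Real.sin (u * (XX n x s - ∑ k ∈ Finset.range n, x k)) ∂ν =
      -(rr n x u * Real.sin (th n x u)) := by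
  have h := congrArg Complex.im (XX_char ν hi hl x n u)
  have hIntg : Integrable (fun s => Complex.exp
      (Complex.I * (u * (XX n x s - ∑ k ∈ Finset.range n, x k) : ℝ))) ν := by
    refine Integrable.of_bound (C := 1) (Measurable.aestronglyMeasurable ?_)
      (ae_of_all _ fun s => ?_)
    · have := XX_meas n x
      fun_prop
    · rw [Complex.norm_exp_I_mul_ofReal]
  have h5 : ∀ y : ℝ, (Complex.exp (Complex.I * y)).im = Real.sin y := by
    intro y; rw [mul_comm, Complex.exp_ofReal_mul_I_im]
  have h6 := integral_im hIntg
  simp only [RCLike.im_to_complex, h5] at h6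
  rw [h6, h]
  have : -Complex.I * (th n x u : ℂ) = Complex.I * ((-th n x u : ℝ) : ℂ) := by push_cast; ring
  rw [Complex.im_ofReal_mul, this, h5, Real.sin_neg]
  ring

lemma coord_memLp (ν : Measure (ℕ → ℝ)) [IsProbabilityMeasure ν]
    (hl : ∀ i, ν.map (fun s => s i) = expMeasure 1) (i : ℕ) : MemLp (fun s : ℕ → ℝ => s i) 2 ν := by
  have h : MemLp (fun s : ℝ => s) 2 (expMeasure 1) :=
    (memLp_two_iff_integrable_sq (by fun_prop)).2 (exp_pow_integrable 2)
  rw [← hl i] at h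
  exact h.comp_of_map (measurable_pi_apply i).aemeasurable

lemma coord_mean (ν : Measure (ℕ → ℝ)) [IsProbabilityMeasure ν]
    (hl : ∀ i, ν.map (fun s => s i) = expMeasure 1) (i : ℕ) : ∫ s, s i ∂ν = 1 := by
  have h := exp_pow_integral 1
  rw [← hl i, integral_map (measurable_pi_apply i).aemeasurable (by fun_prop)] at h
  simpa using h

lemma coord_var (ν : Measure (ℕ → ℝ)) [IsProbabilityMeasure ν]
    (hl : ∀ i, ν.map (fun s => s i) = expMeasure 1) (i : ℕ) : variance (fun s => s i) ν = 1 := by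
  have h := exp_pow_integral 2
  rw [← hl i, integral_map (measurable_pi_apply i).aemeasurable (by fun_prop)] at h
  rw [variance_eq_sub (coord_memLp ν hl i), coord_mean ν hl i]
  simp only [Pi.pow_apply]
  rw [h]
  norm_num [Nat.factorial]

lemma XX_memLp (ν : Measure (ℕ → ℝ)) [IsProbabilityMeasure ν]
    (hl : ∀ i, ν.map (fun s => s i) = expMeasure 1) (x : ℕ → ℝ) (n : ℕ) :
    MemLp (XX n x) 2 ν := by
  have := memLp_finsetSum (μ := ν) (p := 2) (f := fun k (s : ℕ → ℝ) => x k * s k)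
    (Finset.range n) (fun k _ => (coord_memLp ν hl k).const_mul (x k))
  exact this

lemma XX_mean (ν : Measure (ℕ → ℝ)) [IsProbabilityMeasure ν]
    (hl : ∀ i, ν.map (fun s => s i) = expMeasure 1) (x : ℕ → ℝ) (n : ℕ) :
    ∫ s, XX n x s ∂ν = ∑ k ∈ Finset.range n, x k := by
  unfold XX
  rw [integral_finsetSum _ fun k _ =>
    ((coord_memLp ν hl k).integrable (by norm_num)).const_mul (x k)]
  refine Finset.sum_congr rfl fun k _ => ?_
  rw [integral_const_mul, coord_mean ν hl, mul_one]

lemma XX_var (ν : Measure (ℕ → ℝ)) [IsProbabilityMeasure ν]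
    (hi : iIndepFun (fun (i : ℕ) (s : ℕ → ℝ) => s i) ν)
    (hl : ∀ i, ν.map (fun s => s i) = expMeasure 1) (x : ℕ → ℝ) (n : ℕ) :
    variance (XX n x) ν = ∑ k ∈ Finset.range n, x k ^ 2 := by
  have h := IndepFun.variance_sum (μ := ν) (s := Finset.range n)
    (X := fun k (s : ℕ → ℝ) => x k * s k)
    (fun k _ => (coord_memLp ν hl k).const_mul (x k))
    (fun i _ j _ hij => (hi.indepFun hij).comp (φ := fun r => x i * r) (ψ := fun r => x j * r)
      (by fun_prop) (by fun_prop))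
  have he : XX n x = ∑ k ∈ Finset.range n, fun (s : ℕ → ℝ) => x k * s k := by
    ext s; simp [XX]
  rw [he, h]
  refine Finset.sum_congr rfl fun k _ => ?_
  rw [variance_const_mul, coord_var ν hl, mul_one]

lemma finite_bound (ν : Measure (ℕ → ℝ)) [IsProbabilityMeasure ν]
    (hi : iIndepFun (fun (i : ℕ) (s : ℕ → ℝ) => s i) ν)
    (hl : ∀ i, ν.map (fun s => s i) = expMeasure 1) (x : ℕ → ℝ) (hx : ∀ i, 0 ≤ x i) (n : ℕ)
    (hp : 0 < ∑ k ∈ Finset.range n, x k) (t : ℝ) (ht : t ≤ 0) :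
    1 / 2 + t ≤ ν.real {s | XX n x s ≤ ∑ k ∈ Finset.range n, x k +
      √(∑ k ∈ Finset.range n, x k ^ 2) * t} := by
  set m := ∑ k ∈ Finset.range n, x k with hm
  set v := ∑ k ∈ Finset.range n, x k ^ 2 with hv
  have hvpos : 0 < v := by
    obtain ⟨k, hk, hk0⟩ := Finset.exists_ne_zero_of_sum_ne_zero hp.ne'
    exact Finset.sum_pos' (fun i _ => sq_nonneg _) ⟨k, hk, by positivity⟩
  have hσ : 0 < √v := Real.sqrt_pos.2 hvpos
  have hmeas := XX_meas n x
  have hle : ∀ z s, (XX n x s - m) / √v ≤ z ↔ XX n x s ≤ m + √v * z := by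
    intro z s
    rw [div_le_iff₀ hσ, sub_le_iff_le_add', mul_comm]
  have hlt : ∀ z s, z < (XX n x s - m) / √v ↔ m + √v * z < XX n x s := by
    intro z s
    rw [← not_le, hle, not_le]
  have hL2 : MemLp (fun s => (XX n x s - m) / √v) 2 ν := by
    have := ((XX_memLp ν hl x n).sub (memLp_const m)).mul_const (√v)⁻¹
    simpa [div_eq_mul_inv] using this
  have hIntg : Integrable (XX n x) ν := (XX_memLp ν hl x n).integrable (by norm_num)
  have key := core ν (fun s => (XX n x s - m) / √v) (by fun_prop)
    (hL2.integrable (by norm_num)) hL2.integrable_sq ?_ ?_ ?_ ?_ ?_ t ht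
  · simpa only [hle] using key
  · rw [integral_div, integral_sub hIntg (integrable_const m), XX_mean ν hl]
    simp [hm]
  · have h := XX_var ν hi hl x n
    rw [variance_eq_integral hmeas.aemeasurable, XX_mean ν hl, ← hm, ← hv] at h
    simp only [div_pow]
    rw [integral_div, h, Real.sq_sqrt hvpos.le, div_self hvpos.ne']
  · simp only [hle]
    exact LC_affine _ (XX_LC_le ν hi hl x hx n) _ _ hσ.le
  · simp only [hlt]
    exact LC_affine _ (XX_LC_lt ν hi hl x hx n) _ _ hσ.le
  · have h := median ν (fun s => XX n x s - m) (by fun_prop) fun ε hε =>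
      stieltjes_nonpos ν (fun s => XX n x s - m) (by fun_prop)
        (fun u => rr n x u * Real.sin (th n x u)) (fun u _ => XX_sin ν hi hl x n u) ε hε
        (osc n x hx hp ε hε)
    simp only [hle]
    simpa using h

lemma ae_summable (ν : Measure (ℕ → ℝ)) [IsProbabilityMeasure ν]
    (hl : ∀ i, ν.map (fun s => s i) = expMeasure 1) (x : ℕ → ℝ) (hx : ∀ i, 0 ≤ x i)
    (hs : Summable x) : ∀ᵐ s ∂ν, Summable (fun i => x i * s i) := by
  have hnn : ∀ i, ∀ᵐ s ∂ν, 0 ≤ s i := by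
    intro i
    have h := exp_nonneg_ae
    rw [← hl i] at h
    exact ae_of_ae_map (measurable_pi_apply i).aemeasurable h
  have h1 : ∫⁻ s, ∑' i, ENNReal.ofReal (x i * s i) ∂ν = ∑' i, ENNReal.ofReal (x i) := by
    rw [lintegral_tsum (fun i => Measurable.aemeasurable (by fun_prop))]
    refine tsum_congr fun i => ?_
    rw [← ofReal_integral_eq_lintegral_ofReal
      (((coord_memLp ν hl i).integrable (by norm_num)).const_mul (x i)) ?_, integral_const_mul,
      coord_mean ν hl, mul_one]
    filter_upwards [hnn i] with s h
    exact mul_nonneg (hx i) h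
  have h2 : ∫⁻ s, ∑' i, ENNReal.ofReal (x i * s i) ∂ν ≠ ∞ := by
    rw [h1]
    exact hs.tsum_ofReal_ne_top
  have h3 := ae_lt_top (by fun_prop) h2
  filter_upwards [h3, ae_all_iff.2 hnn] with s hs1 hs2
  have := ENNReal.summable_toReal hs1.ne
  refine this.congr fun i => ?_
  exact ENNReal.toReal_ofReal (mul_nonneg (hx i) (hs2 i))

lemma limit_bound {Ω : Type*} [MeasurableSpace Ω] (μ : Measure Ω) [IsProbabilityMeasure μ]
    (Y : ℕ → Ω → ℝ) (Z : Ω → ℝ) (hY : ∀ n, Measurable (Y n))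
    (hlim : ∀ᵐ ω ∂μ, Filter.Tendsto (fun n => Y n ω) Filter.atTop (𝓝 (Z ω))) (c : ℝ)
    (hc : ∀ᶠ n in Filter.atTop, c ≤ μ.real {ω | Y n ω ≤ 0}) : c ≤ μ.real {ω | Z ω ≤ 0} := by
  obtain ⟨N, hN⟩ := Filter.eventually_atTop.1 hc
  let B : ℕ → Set Ω := fun k => ⋃ n, {ω | Y (N + k + n) ω ≤ 0}
  have hBm : ∀ k, MeasurableSet (B k) := fun k =>
    MeasurableSet.iUnion fun n => measurableSet_le (hY _) measurable_const
  have hanti : Antitone B := by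
    refine antitone_nat_of_succ_le fun k ω hω => ?_
    obtain ⟨n, hn⟩ := Set.mem_iUnion.1 hω
    refine Set.mem_iUnion.2 ⟨n + 1, ?_⟩
    have : N + k + (n + 1) = N + (k + 1) + n := by ring
    rw [this]
    exact hn
  have hlimB := tendsto_measure_iInter_atTop (μ := μ)
    (fun k => (hBm k).nullMeasurableSet) hanti ⟨0, measure_ne_top _ _⟩
  have hlimB' : Filter.Tendsto (fun k => μ.real (B k)) Filter.atTop (𝓝 (μ.real (⋂ k, B k))) :=
    (ENNReal.tendsto_toReal (measure_ne_top _ _)).comp hlimB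
  have h1 : c ≤ μ.real (⋂ k, B k) := by
    refine ge_of_tendsto' hlimB' fun k => (hN (N + k + 0) (by omega)).trans ?_
    exact measureReal_mono (Set.subset_iUnion (fun n => {ω | Y (N + k + n) ω ≤ 0}) 0)
  refine h1.trans (ENNReal.toReal_mono (measure_ne_top _ _) (measure_mono_ae ?_))
  filter_upwards [hlim] with ω hω hB
  refine le_of_tendsto_of_frequently hω ?_
  rw [Filter.frequently_atTop]
  intro a
  obtain ⟨n, hn⟩ := Set.mem_iUnion.1 (Set.mem_iInter.1 hB a)
  exact ⟨N + a + n, by omega, hn⟩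

theorem cdf_lower_bound_normalized_exp_sum
    (ν : Measure (ℕ → ℝ)) (hν : IsPiNat (fun _ => expMeasure 1) ν)
    (x : ℕ → ℝ) (hx0 : ∀ i, 0 ≤ x i) (hsummable : Summable x)
    (hpos : 0 < ∑' i, x i) (t : ℝ) (ht : t ≤ 0) :
    (ν {s | (∑' i, x i * s i - ∑' i, x i) / Real.sqrt (∑' i, (x i) ^ 2) ≤ t}).toReal ≥
      max 0 (1 / 2 + t) := by
  obtain ⟨hi, hl⟩ := pi_eq ν hν
  have : IsProbabilityMeasure ν := hν.1
  refine max_le ENNReal.toReal_nonneg ?_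
  have hsq : Summable (fun i => x i ^ 2) := by
    refine Summable.of_norm_bounded_eventually_nat (g := x) hsummable ?_
    filter_upwards [hsummable.tendsto_atTop_zero.eventually_le_const one_pos] with i h
    rw [Real.norm_of_nonneg (sq_nonneg _)]
    nlinarith [hx0 i]
  have hvpos : 0 < ∑' i, x i ^ 2 := by
    by_contra hcon
    have h0 : ∑' i, x i ^ 2 = 0 := le_antisymm (not_lt.1 hcon) (tsum_nonneg fun i => sq_nonneg _)
    have h1 := (hasSum_zero_iff_of_nonneg (fun i => sq_nonneg (x i))).1 (h0 ▸ hsq.hasSum)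
    have h2 : ∀ i, x i = 0 := fun i => by
      have := congrFun h1 i
      simpa using this
    simp [h2] at hpos
  have hσ : 0 < √(∑' i, x i ^ 2) := Real.sqrt_pos.2 hvpos
  have hm := hsummable.hasSum.tendsto_sum_nat
  have hv := hsq.hasSum.tendsto_sum_nat
  have h := limit_bound ν
    (fun n s => XX n x s - (∑ k ∈ Finset.range n, x k + √(∑ k ∈ Finset.range n, x k ^ 2) * t))
    (fun s => ∑' i, x i * s i - (∑' i, x i + √(∑' i, x i ^ 2) * t))
    (fun n => (XX_meas n x).sub_const _) ?_ (1 / 2 + t) ?_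
  · have he : ∀ s : ℕ → ℝ, (∑' i, x i * s i - ∑' i, x i) / √(∑' i, x i ^ 2) ≤ t ↔
        ∑' i, x i * s i - (∑' i, x i + √(∑' i, x i ^ 2) * t) ≤ 0 := by
      intro s
      rw [div_le_iff₀ hσ, sub_nonpos, sub_le_iff_le_add', mul_comm t]
    simp only [he]
    exact h
  · filter_upwards [ae_summable ν hl x hx0 hsummable] with s hs
    exact hs.hasSum.tendsto_sum_nat.sub (hm.add ((hv.sqrt).mul_const t))
  · filter_upwards [hm.eventually_const_lt hpos] with n hn
    have := finite_bound ν hi hl x hx0 n hn t ht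
    simpa only [sub_nonpos] using this
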